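/- (Nonlinear Cauchy interlacing, negative type.) Assume the interval J = (a,b) is of negative type, T is continuously differentiable on (a,b), and let λ_i ∈ (a,b) denote the i-th eigenvalue of T(·) given by the variational principle (the maximum over i-dimensional subspaces of the minimum of ρ). Let 1 ≤ m ≤ n and let U be an n×m complex matrix with linearly independent columns, so that U*T(ν)U is an m×m Hermitian matrix for each ν ∈ [a,b]. Then for each j ∈ {1,…,m} there exists ν_j ∈ (a,b) such that zero is the j-th largest eigenvalue (counted with multiplicity) of U*T(ν_j)U, ν_j equals the maximum over all j-dimensional ℂ-subspaces W ⊆ ℂ^m of the minimum of ρ(Uy) over nonzero y ∈ W, and the interlacing inequalities λ_{n−m+j} ≤ ν_j ≤ λ_j hold. -/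

import Mathlib

open Matrix Set
open scoped ComplexOrder

/-- `0` is the `j`-th largest eigenvalue (counted with multiplicity, `j` zero-based)
of the matrix `A`: the eigenvalues of `A` can be listed in decreasing order with
multiplicity (as the roots of the characteristic polynomial) so that the `j`-th
entry is `0`. -/
def ZeroIsKthLargestEigenvalue {m : ℕ} (A : Matrix (Fin m) (Fin m) ℂ) (k : Fin m) : Prop :=
  ∃ μ : Fin m → ℝ, Antitone μ ∧
    A.charpoly = ∏ i : Fin m, (Polynomial.X - Polynomial.C ((μ i : ℂ))) ∧ μ k = 0

/-- `b` is a basis, orthonormal for the standard Hermitian form, that diagonalizes the Hermitian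
form of `A`, with the eigenvalues `μ` of `A` listed in decreasing order with multiplicity. -/
structure IsSortedEigenbasis {m : ℕ} (A : Matrix (Fin m) (Fin m) ℂ) (μ : Fin m → ℝ)
    (b : Module.Basis (Fin m) ℂ (Fin m → ℂ)) : Prop where
  antitone : Antitone μ
  charpoly_eq : A.charpoly = ∏ i : Fin m, (Polynomial.X - Polynomial.C ((μ i : ℂ)))
  form_eq : ∀ y, (star y ⬝ᵥ A *ᵥ y).re = ∑ i, μ i * ‖b.repr y i‖ ^ 2
  normSq_eq : ∀ y, (star y ⬝ᵥ y).re = ∑ i, ‖b.repr y i‖ ^ 2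

theorem star_dotProduct_self_re {m : ℕ} (y : Fin m → ℂ) :
    (star y ⬝ᵥ y).re = ∑ i, ‖y i‖ ^ 2 := by
  simp only [dotProduct, Complex.re_sum, Pi.star_apply]
  refine Finset.sum_congr rfl fun i _ => ?_
  rw [Complex.star_def, ← Complex.normSq_eq_conj_mul_self, Complex.ofReal_re,
    Complex.normSq_eq_norm_sq]

theorem star_dotProduct_self_re_pos {m : ℕ} {y : Fin m → ℂ} (hy : y ≠ 0) :
    0 < (star y ⬝ᵥ y).re := by
  rw [star_dotProduct_self_re]
  obtain ⟨i, hi⟩ := Function.ne_iff.mp hy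
  exact Finset.sum_pos' (fun _ _ => by positivity)
    ⟨i, Finset.mem_univ _, by have : y i ≠ 0 := hi; positivity⟩

theorem Matrix.IsHermitian.exists_isSortedEigenbasis {m : ℕ} {A : Matrix (Fin m) (Fin m) ℂ}
    (hA : A.IsHermitian) : ∃ μ b, IsSortedEigenbasis A μ b := by
  let f : Fin (Fintype.card (Fin m)) ≃ Fin m := Fintype.equivOfCardEq (Fintype.card_fin _)
  let e : Fin m ≃ Fin m := (finCongr (Fintype.card_fin m)).symm.trans f
  have he : ∀ i, hA.eigenvalues (e i) = hA.eigenvalues₀ (finCongr (Fintype.card_fin m).symm i) := by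
    intro i
    simp [Matrix.IsHermitian.eigenvalues, e, f]
  let V : Matrix (Fin m) (Fin m) ℂ := hA.eigenvectorUnitary
  have hVV : V * star V = 1 := Unitary.coe_mul_star_self hA.eigenvectorUnitary
  have hVV' : star V * V = 1 := Unitary.coe_star_mul_self hA.eigenvectorUnitary
  let c : (Fin m → ℂ) ≃ₗ[ℂ] (Fin m → ℂ) := Matrix.toLin'OfInv hVV hVV'
  let b : Module.Basis (Fin m) ℂ (Fin m → ℂ) := (Module.Basis.ofEquivFun c).reindex e.symm
  have hb : ∀ y i, b.repr y i = (star V *ᵥ y) (e i) := by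
    intro y i
    simp [b, c]
  have hq : ∀ D : Matrix (Fin m) (Fin m) ℂ, ∀ y,
      star y ⬝ᵥ (V * D * star V) *ᵥ y = star (star V *ᵥ y) ⬝ᵥ D *ᵥ (star V *ᵥ y) := by
    intro D y
    rw [Matrix.star_mulVec, ← Matrix.dotProduct_mulVec, Matrix.mulVec_mulVec,
      Matrix.mulVec_mulVec, Matrix.star_eq_conjTranspose, Matrix.conjTranspose_conjTranspose,
      Matrix.mul_assoc]
  refine ⟨fun i => hA.eigenvalues (e i), b, ?_, ?_, ?_, ?_⟩
  · intro i j hij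
    simp only [he]
    exact hA.eigenvalues₀_antitone hij
  · rw [hA.charpoly_eq]
    exact (e.prod_comp fun i => Polynomial.X - Polynomial.C ((hA.eigenvalues i : ℂ))).symm
  · intro y
    have hspec : A = V * diagonal (RCLike.ofReal ∘ hA.eigenvalues) * star V := by
      conv_lhs => rw [hA.spectral_theorem, Unitary.conjStarAlgAut_apply]
    conv_lhs => rw [hspec, hq]
    simp only [hb]
    rw [e.sum_comp fun i => hA.eigenvalues i * ‖(star V *ᵥ y) i‖ ^ 2]
    generalize star V *ᵥ y = z
    simp only [dotProduct, Complex.re_sum, Pi.star_apply, mulVec_diagonal]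
    refine Finset.sum_congr rfl fun i _ => ?_
    rw [mul_left_comm, Complex.star_def, ← Complex.normSq_eq_conj_mul_self,
      Complex.normSq_eq_norm_sq]
    exact Complex.re_ofReal_mul _ _
  · intro y
    have h := hq 1 y
    rw [mul_one, hVV, one_mulVec, one_mulVec] at h
    rw [h, star_dotProduct_self_re]
    simp only [hb]
    exact (e.sum_comp fun i => ‖(star V *ᵥ y) i‖ ^ 2).symm

theorem Module.Basis.repr_eq_zero_of_mem_span_image {ι R M : Type*} [Semiring R] [AddCommMonoid M]
    [Module R M] (b : Module.Basis ι R M) {s : Set ι} {y : M}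
    (hy : y ∈ Submodule.span R (b '' s)) {i : ι} (hi : i ∉ s) : b.repr y i = 0 := by
  by_contra h
  exact hi (b.mem_span_image.mp hy (Finsupp.mem_support_iff.mpr h))

theorem Module.Basis.finrank_span_image {ι K M : Type*} [Field K] [AddCommGroup M]
    [Module K M] [DecidableEq M] (b : Module.Basis ι K M) (s : Finset ι) :
    Module.finrank K (Submodule.span K (b '' (s : Set ι))) = s.card := by
  have h := finrank_span_finset_eq_card (R := K) (s := s.image b) (by
    rw [Finset.coe_image]
    exact (b.linearIndependent.linearIndepOn_id.mono (Set.image_subset_range _ _)))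
  rw [Finset.coe_image, Finset.card_image_of_injective _ b.injective] at h
  exact h

theorem Submodule.exists_ne_zero_mem_of_finrank_lt {K M : Type*} [Field K] [AddCommGroup M]
    [Module K M] [FiniteDimensional K M] (S W : Submodule K M)
    (h : Module.finrank K M < Module.finrank K S + Module.finrank K W) :
    ∃ y ∈ S, y ∈ W ∧ y ≠ 0 := by
  have h1 := Submodule.finrank_sup_add_finrank_inf_eq S W
  have h2 := Submodule.finrank_le (S ⊔ W)
  obtain ⟨y, hy, h0⟩ := (Submodule.ne_bot_iff (S ⊓ W)).mp
    ((Submodule.one_le_finrank_iff).mp (by omega))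
  exact ⟨y, hy.1, hy.2, h0⟩

namespace IsSortedEigenbasis

variable {m : ℕ} {A B : Matrix (Fin m) (Fin m) ℂ} {μ η : Fin m → ℝ}
  {b d : Module.Basis (Fin m) ℂ (Fin m → ℂ)}

theorem le_form (h : IsSortedEigenbasis A μ b) {j : Fin m} {y : Fin m → ℂ}
    (hy : y ∈ Submodule.span ℂ (b '' Set.Iic j)) :
    μ j * (star y ⬝ᵥ y).re ≤ (star y ⬝ᵥ A *ᵥ y).re := by
  rw [h.form_eq, h.normSq_eq, Finset.mul_sum]
  refine Finset.sum_le_sum fun i _ => ?_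
  by_cases hi : i ≤ j
  · exact mul_le_mul_of_nonneg_right (h.antitone hi) (by positivity)
  · simp [b.repr_eq_zero_of_mem_span_image hy hi]

theorem form_le (h : IsSortedEigenbasis A μ b) {j : Fin m} {y : Fin m → ℂ}
    (hy : y ∈ Submodule.span ℂ (b '' Set.Ici j)) :
    (star y ⬝ᵥ A *ᵥ y).re ≤ μ j * (star y ⬝ᵥ y).re := by
  rw [h.form_eq, h.normSq_eq, Finset.mul_sum]
  refine Finset.sum_le_sum fun i _ => ?_
  by_cases hi : j ≤ i
  · exact mul_le_mul_of_nonneg_right (h.antitone hi) (by positivity)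
  · simp [b.repr_eq_zero_of_mem_span_image hy hi]

theorem form_basis (h : IsSortedEigenbasis A μ b) (j : Fin m) :
    (star (b j) ⬝ᵥ A *ᵥ b j).re = μ j * (star (b j) ⬝ᵥ b j).re :=
  le_antisymm (h.form_le (Submodule.subset_span ⟨j, Set.mem_Ici.mpr le_rfl, rfl⟩))
    (h.le_form (Submodule.subset_span ⟨j, Set.mem_Iic.mpr le_rfl, rfl⟩))

theorem finrank_span_Iic (b : Module.Basis (Fin m) ℂ (Fin m → ℂ)) (j : Fin m) :
    Module.finrank ℂ (Submodule.span ℂ (b '' Set.Iic j)) = j + 1 := by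
  classical
  rw [← Finset.coe_Iic, b.finrank_span_image, Fin.card_Iic]

theorem exists_form_le (h : IsSortedEigenbasis A μ b) (j : Fin m)
    (W : Submodule ℂ (Fin m → ℂ)) (hW : (j : ℕ) + 1 ≤ Module.finrank ℂ W) :
    ∃ y ∈ W, y ≠ 0 ∧ (star y ⬝ᵥ A *ᵥ y).re ≤ μ j * (star y ⬝ᵥ y).re := by
  classical
  have hd : Module.finrank ℂ (Submodule.span ℂ (b '' Set.Ici j)) = m - j := by
    rw [← Finset.coe_Ici, b.finrank_span_image, Fin.card_Ici]
  obtain ⟨y, hyW, hy, hy0⟩ := Submodule.exists_ne_zero_mem_of_finrank_lt W _ (by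
    rw [hd, Module.finrank_fin_fun]
    have := j.isLt
    omega)
  exact ⟨y, hyW, hy0, h.form_le hy⟩

theorem eigenvalue_le (hA : IsSortedEigenbasis A μ b) (hB : IsSortedEigenbasis B η d) {ε : ℝ}
    (hAB : ∀ y, (star y ⬝ᵥ A *ᵥ y).re ≤ (star y ⬝ᵥ B *ᵥ y).re + ε * (star y ⬝ᵥ y).re)
    (j : Fin m) : μ j ≤ η j + ε := by
  obtain ⟨y, hy, hy0, hle⟩ := hB.exists_form_le j _ (finrank_span_Iic b j).ge
  have h1 := hA.le_form hy
  have h2 := hAB y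
  refine le_of_mul_le_mul_right ?_ (star_dotProduct_self_re_pos hy0)
  linarith

end IsSortedEigenbasis

theorem form_re_le_sum_norm {m : ℕ} (A : Matrix (Fin m) (Fin m) ℂ) (y : Fin m → ℂ) :
    (star y ⬝ᵥ A *ᵥ y).re ≤ (∑ i, ∑ k, ‖A i k‖) * (star y ⬝ᵥ y).re := by
  rw [star_dotProduct_self_re]
  have hN : ∀ i, ‖y i‖ ^ 2 ≤ ∑ l, ‖y l‖ ^ 2 := fun i =>
    Finset.single_le_sum (f := fun l => ‖y l‖ ^ 2) (fun _ _ => by positivity) (Finset.mem_univ i)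
  generalize ∑ l, ‖y l‖ ^ 2 = N at hN ⊢
  simp only [dotProduct, mulVec, Finset.mul_sum, Finset.sum_mul, Complex.re_sum, Pi.star_apply]
  refine Finset.sum_le_sum fun i _ => Finset.sum_le_sum fun k _ => ?_
  calc (star (y i) * (A i k * y k)).re ≤ ‖star (y i) * (A i k * y k)‖ := Complex.re_le_norm _
    _ = ‖A i k‖ * (‖y i‖ * ‖y k‖) := by rw [norm_mul, norm_mul, norm_star]; ring
    _ ≤ ‖A i k‖ * N := by
      refine mul_le_mul_of_nonneg_left ?_ (norm_nonneg _)
      nlinarith [hN i, hN k, sq_nonneg (‖y i‖ - ‖y k‖)]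

/-- Weyl's inequality makes sorted eigenvalues continuous. -/
theorem IsSortedEigenbasis.continuous_eigenvalue {X : Type*} [TopologicalSpace X] {m : ℕ}
    {A : X → Matrix (Fin m) (Fin m) ℂ} {μ : X → Fin m → ℝ}
    {b : X → Module.Basis (Fin m) ℂ (Fin m → ℂ)}
    (h : ∀ x, IsSortedEigenbasis (A x) (μ x) (b x)) (hA : Continuous A) (j : Fin m) :
    Continuous fun x => μ x j := by
  have key : ∀ x x', μ x j ≤ μ x' j + ∑ i, ∑ k, ‖(A x - A x') i k‖ := fun x x' =>
    (h x).eigenvalue_le (h x') (fun y => by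
      have := form_re_le_sum_norm (A x - A x') y
      rw [sub_mulVec, dotProduct_sub, Complex.sub_re] at this
      linarith) j
  refine continuous_iff_continuousAt.mpr fun x₀ => ?_
  refine tendsto_iff_dist_tendsto_zero.mpr ?_
  have hlim : Filter.Tendsto (fun x => ∑ i, ∑ k, ‖(A x - A x₀) i k‖) (nhds x₀) (nhds 0) := by
    have hc : Continuous fun x => ∑ i, ∑ k, ‖(A x - A x₀) i k‖ := by
      refine continuous_finsetSum _ fun i _ => continuous_finsetSum _ fun k _ => ?_
      exact ((hA.sub continuous_const).matrix_elem i k).norm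
    simpa using hc.tendsto x₀
  refine squeeze_zero (fun _ => dist_nonneg) (fun x => ?_) hlim
  rw [Real.dist_eq, abs_le]
  have h1 := key x x₀
  have h2 := key x₀ x
  have h3 : ∑ i, ∑ k, ‖(A x₀ - A x) i k‖ = ∑ i, ∑ k, ‖(A x - A x₀) i k‖ := by
    exact Finset.sum_congr rfl fun i _ => Finset.sum_congr rfl fun k _ => norm_sub_rev _ _
  constructor <;> linarith

/-- nonlinear Cauchy interlacing theorem, negative type.  If `(a,b)` is
of negative type, `T` is continuously differentiable on `(a,b)`, `lam i` is the
`i`-th eigenvalue given by the variational principle (zero-based), and `U` is an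
`n×m` matrix with linearly independent columns, then for each `j` (zero-based) the
projected problem `Uᴴ T(ν) U` has a `j`-th eigenvalue `ν j ∈ (a,b)` given by the
max-min principle for `y ↦ ρ(U y)`, and `lam (n-m+j) ≤ ν j ≤ lam j`. -/
theorem nonlinear_cauchy_interlacing_negative_type
    (n m : ℕ) (hn : 1 ≤ n) (hm : 1 ≤ m) (hmn : m ≤ n)
    (a b : ℝ) (hab : a < b)
    (T T' : ℝ → Matrix (Fin n) (Fin n) ℂ)
    (hTcont : ContinuousOn T (Set.Icc a b))
    (hTherm : ∀ μ ∈ Set.Icc a b, (T μ).IsHermitian)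
    (hT'deriv : ∀ μ ∈ Set.Ioo a b, ∀ i j : Fin n,
      HasDerivAt (fun t : ℝ => T t i j) (T' μ i j) μ)
    (hT'cont : ContinuousOn T' (Set.Ioo a b))
    (ρ : (Fin n → ℂ) → ℝ)
    (hρcont : ContinuousOn ρ {x : Fin n → ℂ | x ≠ 0})
    (hρmem : ∀ x : Fin n → ℂ, x ≠ 0 → ρ x ∈ Set.Ioo a b)
    (hρroot : ∀ x : Fin n → ℂ, x ≠ 0 → star x ⬝ᵥ (T (ρ x)) *ᵥ x = 0)
    (hρuniq : ∀ x : Fin n → ℂ, x ≠ 0 → ∀ μ ∈ Set.Ioo a b,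
      star x ⬝ᵥ (T μ) *ᵥ x = 0 → μ = ρ x)
    (hneg : ∀ x : Fin n → ℂ, x ≠ 0 → ∀ μ ∈ Set.Ioo a b, μ ≠ ρ x →
      (μ - ρ x) * (star x ⬝ᵥ (T μ) *ᵥ x).re < 0)
    (lam : Fin n → ℝ)
    (hlam_mem : ∀ i : Fin n, lam i ∈ Set.Ioo a b)
    (hlam : ∀ i : Fin n,
      IsGreatest {r : ℝ | ∃ S : Submodule ℂ (Fin n → ℂ), Module.finrank ℂ S = (i : ℕ) + 1 ∧
        IsLeast (ρ '' {x : Fin n → ℂ | x ∈ S ∧ x ≠ 0}) r} (lam i))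
    (U : Matrix (Fin n) (Fin m) ℂ)
    (hU : LinearIndependent ℂ (fun j : Fin m => (fun i : Fin n => U i j))) :
    ∀ j : Fin m, ∃ ν ∈ Set.Ioo a b,
      ZeroIsKthLargestEigenvalue (Uᴴ * T ν * U) j ∧
      IsGreatest {r : ℝ | ∃ W : Submodule ℂ (Fin m → ℂ), Module.finrank ℂ W = (j : ℕ) + 1 ∧
        IsLeast ((fun y => ρ (U *ᵥ y)) '' {y : Fin m → ℂ | y ∈ W ∧ y ≠ 0}) r} ν ∧
      lam ⟨n - m + (j : ℕ), by have := j.isLt; omega⟩ ≤ ν ∧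
      ν ≤ lam ⟨(j : ℕ), lt_of_lt_of_le j.isLt hmn⟩ := by
  have hUinj : Function.Injective (U.mulVec) := Matrix.mulVec_injective_iff.mpr hU
  have hU0 : ∀ y : Fin m → ℂ, y ≠ 0 → U *ᵥ y ≠ 0 := fun y hy h =>
    hy (hUinj (by rw [h, mulVec_zero]))
  have hform : ∀ ν y, star y ⬝ᵥ (Uᴴ * T ν * U) *ᵥ y = star (U *ᵥ y) ⬝ᵥ T ν *ᵥ (U *ᵥ y) := by
    intro ν y
    rw [Matrix.star_mulVec, ← Matrix.dotProduct_mulVec, Matrix.mulVec_mulVec,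
      Matrix.mulVec_mulVec, Matrix.mul_assoc]
  have hpos : ∀ ν ∈ Set.Ioo a b, ∀ y : Fin m → ℂ, y ≠ 0 → ν < ρ (U *ᵥ y) →
      0 < (star y ⬝ᵥ (Uᴴ * T ν * U) *ᵥ y).re := by
    intro ν hν y hy hlt
    have := hneg _ (hU0 y hy) ν hν hlt.ne
    rw [hform]
    exact pos_of_mul_neg_right this (by linarith)
  have hnegform : ∀ ν ∈ Set.Ioo a b, ∀ y : Fin m → ℂ, y ≠ 0 → ρ (U *ᵥ y) < ν →
      (star y ⬝ᵥ (Uᴴ * T ν * U) *ᵥ y).re < 0 := by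
    intro ν hν y hy hlt
    have := hneg _ (hU0 y hy) ν hν hlt.ne'
    rw [hform]
    exact neg_of_mul_neg_right this (by linarith)
  intro j
  have hherm : ∀ ν : Set.Ioo a b, (Uᴴ * T ν * U).IsHermitian := fun ν =>
    isHermitian_conjTranspose_mul_mul U (hTherm ν (Set.Ioo_subset_Icc_self ν.2))
  choose μ v hμ using fun ν : Set.Ioo a b => (hherm ν).exists_isSortedEigenbasis
  have hAcont : Continuous fun ν : Set.Ioo a b => Uᴴ * T ν * U := by
    have hT : Continuous fun ν : Set.Ioo a b => T ν :=
      (hTcont.mono Set.Ioo_subset_Icc_self).domRestrict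
    exact (continuous_const.matrix_mul hT).matrix_mul continuous_const
  have hμcont : Continuous fun ν => μ ν j :=
    IsSortedEigenbasis.continuous_eigenvalue hμ hAcont j
  have : Nonempty (Fin m) := ⟨j⟩
  have hK : IsCompact (Metric.sphere (0 : Fin m → ℂ) 1) := isCompact_sphere _ _
  have hKne : (Metric.sphere (0 : Fin m → ℂ) 1).Nonempty :=
    NormedSpace.sphere_nonempty.mpr zero_le_one
  have hK0 : ∀ y ∈ Metric.sphere (0 : Fin m → ℂ) 1, y ≠ 0 := fun y hy h => by
    simp [h] at hy
  have hσ : ContinuousOn (fun y : Fin m → ℂ => ρ (U *ᵥ y)) (Metric.sphere 0 1) :=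
    hρcont.comp (continuous_const.matrix_mulVec continuous_id).continuousOn
      fun y hy => hU0 y (hK0 y hy)
  have hunit : ∀ ν : Set.Ioo a b, ∃ y ∈ Metric.sphere (0 : Fin m → ℂ) 1, ∃ r > 0,
      (star y ⬝ᵥ (Uᴴ * T ν * U) *ᵥ y).re = μ ν j * r := by
    intro ν
    have hv0 : v ν j ≠ 0 := (v ν).ne_zero j
    have hy : (((‖v ν j‖⁻¹ : ℝ) : ℂ) • v ν j) ∈ Metric.sphere (0 : Fin m → ℂ) 1 := by
      rw [mem_sphere_zero_iff_norm, norm_smul, Complex.norm_real, norm_inv, norm_norm,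
        inv_mul_cancel₀ (norm_ne_zero_iff.mpr hv0)]
    refine ⟨_, hy, _, star_dotProduct_self_re_pos (hK0 _ hy), ?_⟩
    have hIic := Submodule.subset_span (R := ℂ) (s := v ν '' Set.Iic j) ⟨j, Set.mem_Iic.mpr le_rfl, rfl⟩
    have hIci := Submodule.subset_span (R := ℂ) (s := v ν '' Set.Ici j) ⟨j, Set.mem_Ici.mpr le_rfl, rfl⟩
    exact le_antisymm ((hμ ν).form_le (Submodule.smul_mem _ _ hIci))
      ((hμ ν).le_form (Submodule.smul_mem _ _ hIic))
  obtain ⟨ν, hν⟩ : ∃ ν, μ ν j = 0 := by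
    have : PreconnectedSpace (Set.Ioo a b) := Subtype.preconnectedSpace isPreconnected_Ioo
    refine mem_range_of_exists_le_of_exists_ge hμcont ?_ ?_
    · obtain ⟨y₀, hy₀, hmax⟩ := hK.exists_isMaxOn hKne hσ
      have hmem := hρmem _ (hU0 y₀ (hK0 y₀ hy₀))
      obtain ⟨t, ht, htb⟩ := exists_between hmem.2
      have htm : t ∈ Set.Ioo a b := ⟨hmem.1.trans ht, htb⟩
      obtain ⟨y, hy, r, hr, heq⟩ := hunit ⟨t, htm⟩
      have := hnegform t htm y (hK0 y hy) ((hmax hy).trans_lt ht)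
      exact ⟨⟨t, htm⟩, (neg_of_mul_neg_left (heq ▸ this) hr.le).le⟩
    · obtain ⟨y₀, hy₀, hmin⟩ := hK.exists_isMinOn hKne hσ
      have hmem := hρmem _ (hU0 y₀ (hK0 y₀ hy₀))
      obtain ⟨t, hta, ht⟩ := exists_between hmem.1
      have htm : t ∈ Set.Ioo a b := ⟨hta, ht.trans hmem.2⟩
      obtain ⟨y, hy, r, hr, heq⟩ := hunit ⟨t, htm⟩
      have := hpos t htm y (hK0 y hy) (ht.trans_le (hmin hy))
      exact ⟨⟨t, htm⟩, (pos_of_mul_pos_left (heq ▸ this) hr.le).le⟩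
  have hle : ∀ W : Submodule ℂ (Fin m → ℂ), (j : ℕ) + 1 ≤ Module.finrank ℂ W →
      ∃ y ∈ W, y ≠ 0 ∧ ρ (U *ᵥ y) ≤ ν := by
    intro W hW
    obtain ⟨y, hyW, hy0, hy⟩ := (hμ ν).exists_form_le j W hW
    rw [hν, zero_mul] at hy
    exact ⟨y, hyW, hy0, le_of_not_gt fun hlt => (hpos ν ν.2 y hy0 hlt).not_ge hy⟩
  have hgreatest : IsGreatest {r : ℝ | ∃ W : Submodule ℂ (Fin m → ℂ),
      Module.finrank ℂ W = (j : ℕ) + 1 ∧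
        IsLeast ((fun y => ρ (U *ᵥ y)) '' {y : Fin m → ℂ | y ∈ W ∧ y ≠ 0}) r} ν := by
    constructor
    · refine ⟨Submodule.span ℂ (v ν '' Set.Iic j),
        IsSortedEigenbasis.finrank_span_Iic _ j, ⟨v ν j, ⟨Submodule.subset_span ⟨j, Set.mem_Iic.mpr le_rfl, rfl⟩,
          (v ν).ne_zero j⟩, ?_⟩, ?_⟩
      · have h0 := (hμ ν).form_basis j
        rw [hν, zero_mul] at h0
        exact le_antisymm (le_of_not_gt fun hlt => (hpos ν ν.2 _ ((v ν).ne_zero j) hlt).ne' h0)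
          (le_of_not_gt fun hlt => (hnegform ν ν.2 _ ((v ν).ne_zero j) hlt).ne h0)
      · rintro _ ⟨y, ⟨hyW, hy0⟩, rfl⟩
        have h0 := (hμ ν).le_form hyW
        rw [hν, zero_mul] at h0
        exact le_of_not_gt fun hlt => (hnegform ν ν.2 y hy0 hlt).not_ge h0
    · rintro r ⟨W, hW, -, hr⟩
      obtain ⟨y, hyW, hy0, hy⟩ := hle W hW.ge
      exact (hr ⟨y, ⟨hyW, hy0⟩, rfl⟩).trans hy
  refine ⟨ν, ν.2, ⟨μ ν, (hμ ν).antitone, (hμ ν).charpoly_eq, hν⟩, hgreatest, ?_, ?_⟩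
  · obtain ⟨S, hS, -, hmin⟩ := (hlam ⟨n - m + (j : ℕ), by have := j.isLt; omega⟩).1
    have hrange : Module.finrank ℂ (LinearMap.range U.mulVecLin) = m := by
      rw [LinearMap.finrank_range_of_inj hUinj, Module.finrank_fin_fun]
    have hcomap : Module.finrank ℂ (S.comap U.mulVecLin) =
        Module.finrank ℂ (LinearMap.range U.mulVecLin ⊓ S : Submodule ℂ (Fin n → ℂ)) := by
      rw [← Submodule.map_comap_eq]
      exact (LinearEquiv.finrank_eq (Submodule.equivMapOfInjective _ hUinj _))
    have h1 := Submodule.finrank_sup_add_finrank_inf_eq (LinearMap.range U.mulVecLin) S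
    have h2 := Submodule.finrank_le (LinearMap.range U.mulVecLin ⊔ S)
    rw [Module.finrank_fin_fun] at h2
    obtain ⟨y, hyW, hy0, hy⟩ := hle (S.comap U.mulVecLin) (by
      rw [hcomap]
      simp only at hS
      omega)
    exact (hmin ⟨U *ᵥ y, ⟨hyW, hU0 y hy0⟩, rfl⟩).trans hy
  · obtain ⟨W, hW, hmin⟩ := hgreatest.1
    refine (hlam ⟨(j : ℕ), lt_of_lt_of_le j.isLt hmn⟩).2 ⟨W.map U.mulVecLin, ?_, ?_⟩
    · rw [← hW]
      exact (LinearEquiv.finrank_eq (Submodule.equivMapOfInjective _ hUinj W)).symm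
    · convert hmin using 1
      ext r
      constructor
      · rintro ⟨_, ⟨⟨y, hy, rfl⟩, hy0⟩, rfl⟩
        exact ⟨y, ⟨hy, fun h => hy0 (by simp [h])⟩, rfl⟩
      · rintro ⟨y, ⟨hy, hy0⟩, rfl⟩
        exact ⟨U *ᵥ y, ⟨⟨y, hy, rfl⟩, hU0 y hy0⟩, rfl⟩
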